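/- Let γ_N be the Gaussian distribution on ℝ with mean 0 and variance (N−1)/N (the same mean and variance as the empirical distribution 𝕡_N). Then for every 1-Lipschitz function h : ℝ → ℝ (i.e., |h(a) − h(b)| ≤ |a − b| for all a, b), |(1/N) Σ_{n=1}^N h(x_{N,n}) − ∫_ℝ h dγ_N| ≤ 4 x_{N,1}/(N−1); that is, the Wasserstein distance between 𝕡_N and γ_N is at most 4 x_{N,1}/(N−1). -/

import Mathlib

open Finset

/-- Partial sum `S_n = x_1 + ... + x_n`. -/
noncomputable def S (x : ℕ → ℝ) (n : ℕ) : ℝ := ∑ i ∈ Finset.Icc 1 n, x i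

/-- `x_1, ..., x_N` is a solution of the recursion `x_{n+1} = x_n - 1/S_n`
with all relevant partial sums nonzero. -/
def IsSolution (N : ℕ) (x : ℕ → ℝ) : Prop :=
  ∀ n, 1 ≤ n → n ≤ N - 1 → S x n ≠ 0 ∧ x (n + 1) = x n - 1 / S x n

/-- Zero-median property: the middle value is `0` when `N` is odd, and the two middle
values are negatives of each other when `N` is even. -/
def ZeroMedian (N : ℕ) (x : ℕ → ℝ) : Prop :=
  (Odd N → x ((N + 1) / 2) = 0) ∧ (Even N → x (N / 2) = - x (N / 2 + 1))
open MeasureTheory ProbabilityTheory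
open scoped NNReal

section GaussianTail

/-- The unnormalised standard Gaussian density. -/
noncomputable def gaussianWeight (t : ℝ) : ℝ := Real.exp (-(1 / 2) * t ^ 2)

lemma gaussianWeight_pos (t : ℝ) : 0 < gaussianWeight t := Real.exp_pos _

lemma gaussianWeight_neg (t : ℝ) : gaussianWeight (-t) = gaussianWeight t := by
  simp [gaussianWeight]

lemma hasDerivAt_gaussianWeight (t : ℝ) :
    HasDerivAt gaussianWeight (-t * gaussianWeight t) t := by
  have := (((hasDerivAt_id t).pow 2).const_mul (-(1 / 2 : ℝ))).exp
  refine this.congr_deriv ?_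
  simp [gaussianWeight]
  ring

lemma continuous_gaussianWeight : Continuous gaussianWeight :=
  continuous_iff_continuousAt.2 fun t => (hasDerivAt_gaussianWeight t).continuousAt

lemma integrable_pow_mul_gaussianWeight (k : ℕ) :
    Integrable fun t => t ^ k * gaussianWeight t := by
  have hk : (-1 : ℝ) < k := lt_of_lt_of_le (by norm_num) (Nat.cast_nonneg k)
  simpa [gaussianWeight] using
    integrable_rpow_mul_exp_neg_mul_sq (b := 1 / 2) (by norm_num) hk

lemma integrable_gaussianWeight : Integrable gaussianWeight := by
  simpa using integrable_pow_mul_gaussianWeight 0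

lemma integrable_id_mul_gaussianWeight : Integrable fun t => t * gaussianWeight t := by
  simpa using integrable_pow_mul_gaussianWeight 1

lemma integrable_mul_gaussianWeight_of_abs_le {u : ℝ → ℝ} (hu : Continuous u) {C : ℝ}
    (hC : ∀ t, |u t| ≤ |t| + C) : Integrable fun t => u t * gaussianWeight t := by
  have h : Integrable fun t => |t| * gaussianWeight t + C * gaussianWeight t := by
    refine Integrable.add ?_ (integrable_gaussianWeight.const_mul C)
    refine integrable_id_mul_gaussianWeight.norm.congr (ae_of_all _ fun t => ?_)
    simp [abs_of_pos (gaussianWeight_pos t)]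
  refine h.mono' (hu.mul continuous_gaussianWeight).aestronglyMeasurable
    (ae_of_all _ fun t => ?_)
  rw [Real.norm_eq_abs, abs_mul, abs_of_pos (gaussianWeight_pos t), ← add_mul]
  exact mul_le_mul_of_nonneg_right (hC t) (gaussianWeight_pos t).le

lemma tendsto_pow_mul_gaussianWeight (k : ℕ) :
    Filter.Tendsto (fun t => t ^ k * gaussianWeight t) Filter.atTop (nhds 0) := by
  have h := (tendsto_rpow_abs_mul_exp_neg_mul_sq_cocompact (a := 1 / 2) (by norm_num) k).mono_left
    atTop_le_cocompact
  refine h.congr' ?_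
  filter_upwards [Filter.eventually_ge_atTop 0] with t ht
  simp [gaussianWeight, abs_of_nonneg ht]

lemma integral_Ioi_id_mul_gaussianWeight (w : ℝ) :
    ∫ t in Set.Ioi w, t * gaussianWeight t = gaussianWeight w := by
  have h := integral_Ioi_of_hasDerivAt_of_tendsto' (a := w) (m := 0)
    (f := fun t => -gaussianWeight t) (f' := fun t => t * gaussianWeight t)
    (fun t _ => (hasDerivAt_gaussianWeight t).neg.congr_deriv (by ring))
    integrable_id_mul_gaussianWeight.integrableOn
    (by simpa using (tendsto_pow_mul_gaussianWeight 0).neg)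
  simpa using h

lemma integral_Ioi_sq_mul_gaussianWeight (w : ℝ) :
    ∫ t in Set.Ioi w, t ^ 2 * gaussianWeight t =
      w * gaussianWeight w + ∫ t in Set.Ioi w, gaussianWeight t := by
  have h := integral_Ioi_of_hasDerivAt_of_tendsto' (a := w) (m := 0)
    (f := fun t => -(t * gaussianWeight t))
    (f' := fun t => t ^ 2 * gaussianWeight t - gaussianWeight t)
    (fun t _ => ((hasDerivAt_id t).mul (hasDerivAt_gaussianWeight t)).neg.congr_deriv
      (by simp; ring))
    ((integrable_pow_mul_gaussianWeight 2).sub integrable_gaussianWeight).integrableOn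
    (by simpa using (tendsto_pow_mul_gaussianWeight 1).neg)
  rw [integral_sub (integrable_pow_mul_gaussianWeight 2).integrableOn
    integrable_gaussianWeight.integrableOn] at h
  linarith

/-- The tail of the second moment about `w` is nonnegative: a lower bound for the Mills ratio. -/
lemma mul_gaussianWeight_le_tail (w : ℝ) :
    w * gaussianWeight w ≤ (1 + w ^ 2) * ∫ t in Set.Ioi w, gaussianWeight t := by
  have h0 : 0 ≤ ∫ t in Set.Ioi w, (t - w) ^ 2 * gaussianWeight t :=
    integral_nonneg fun t => mul_nonneg (sq_nonneg _) (gaussianWeight_pos t).le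
  have h1 : ∫ t in Set.Ioi w, (t - w) ^ 2 * gaussianWeight t =
      ∫ t in Set.Ioi w, ((t ^ 2 * gaussianWeight t - 2 * w * (t * gaussianWeight t)) +
        w ^ 2 * gaussianWeight t) :=
    integral_congr_ae (ae_of_all _ fun t => by ring)
  rw [h1, integral_add, integral_sub, integral_const_mul, integral_const_mul,
    integral_Ioi_id_mul_gaussianWeight, integral_Ioi_sq_mul_gaussianWeight] at h0
  · linarith
  · exact (integrable_pow_mul_gaussianWeight 2).integrableOn
  · exact (integrable_id_mul_gaussianWeight.const_mul _).integrableOn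
  · exact ((integrable_pow_mul_gaussianWeight 2).sub
      (integrable_id_mul_gaussianWeight.const_mul _)).integrableOn
  · exact (integrable_gaussianWeight.const_mul _).integrableOn

lemma integral_Ioi_sub_mul_gaussianWeight (w : ℝ) :
    ∫ t in Set.Ioi w, (t - w) * gaussianWeight t =
      gaussianWeight w - w * ∫ t in Set.Ioi w, gaussianWeight t := by
  simp_rw [sub_mul]
  rw [integral_sub integrable_id_mul_gaussianWeight.integrableOn
    (integrable_gaussianWeight.const_mul _).integrableOn, integral_const_mul,
    integral_Ioi_id_mul_gaussianWeight]

lemma tail_gaussianWeight_le {w : ℝ} (hw : 0 ≤ w) :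
    ∫ t in Set.Ioi w, gaussianWeight t ≤ 2 * gaussianWeight w := by
  have hexp : Real.exp (1 / 2) ≤ 2 := by
    have h := Real.exp_one_lt_d9
    have h2 : Real.exp (1 / 2) ^ 2 = Real.exp 1 := by
      rw [← Real.exp_nat_mul]; norm_num
    nlinarith [Real.exp_pos (1 / 2)]
  have hle : ∫ t in Set.Ioi w, gaussianWeight t ≤
      ∫ t in Set.Ioi w, gaussianWeight w * Real.exp (1 / 2 + w) * Real.exp (-t) := by
    refine setIntegral_mono_on integrable_gaussianWeight.integrableOn
      ((integrableOn_exp_neg_Ioi w).const_mul _) measurableSet_Ioi fun t ht => ?_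
    rw [gaussianWeight, gaussianWeight, ← Real.exp_add, ← Real.exp_add, Real.exp_le_exp]
    nlinarith [sq_nonneg (t - w - 1), mul_nonneg hw (sub_nonneg.2 (le_of_lt ht))]
  rw [integral_const_mul, integral_exp_neg_Ioi, mul_assoc, ← Real.exp_add] at hle
  rw [show 1 / 2 + w + -w = 1 / 2 by ring] at hle
  nlinarith [gaussianWeight_pos w]

lemma integral_gaussianReal_zero_one (h : ℝ → ℝ) :
    ∫ t, h t ∂gaussianReal 0 1 = (√(2 * Real.pi))⁻¹ * ∫ t, h t * gaussianWeight t := by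
  rw [integral_gaussianReal_eq_integral_smul one_ne_zero, ← integral_const_mul]
  refine integral_congr_ae (ae_of_all _ fun t => ?_)
  simp only [gaussianPDFReal, gaussianWeight, smul_eq_mul]
  simp
  ring_nf

lemma integral_abs_gaussianReal_zero_one_le : ∫ t, |t| ∂gaussianReal 0 1 ≤ 1 := by
  have hm : MemLp id 2 (gaussianReal 0 1) := memLp_id_gaussianReal' 2 (by simp)
  have hsq : ∫ t, t ^ 2 ∂gaussianReal 0 1 = 1 := by
    have h := variance_id_gaussianReal (μ := 0) (v := 1)
    rw [variance_eq_sub hm] at h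
    simpa [integral_id_gaussianReal] using h
  have hi : Integrable (fun t => t ^ 2) (gaussianReal 0 1) := hm.integrable_sq
  have hle : ∫ t, |t| ∂gaussianReal 0 1 ≤ ∫ t, (1 / 2 + (1 / 2) * t ^ 2) ∂gaussianReal 0 1 := by
    refine integral_mono (hm.integrable (by norm_num)).norm
      ((integrable_const _).add (hi.const_mul _)) fun t => ?_
    have := sq_nonneg (|t| - 1)
    have := sq_abs t
    change |t| ≤ 1 / 2 + (1 / 2) * t ^ 2
    nlinarith
  rw [integral_add (integrable_const _) (hi.const_mul _), integral_const_mul, hsq] at hle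
  simpa using hle.trans (by norm_num)

end GaussianTail

section Stein

lemma continuous_of_abs_sub_le {h : ℝ → ℝ} (hLip : ∀ a b, |h a - h b| ≤ |a - b|) :
    Continuous h :=
  (LipschitzWith.of_dist_le_mul (K := 1) fun a b => by
    simpa [Real.dist_eq] using hLip a b).continuous

lemma abs_le_abs_add_of_abs_sub_le {h : ℝ → ℝ} (hLip : ∀ a b, |h a - h b| ≤ |a - b|) (t : ℝ) :
    |h t| ≤ |t| + |h 0| := by
  have h1 := hLip t 0
  have h2 := abs_sub_abs_le_abs_sub (h t) (h 0)
  rw [sub_zero] at h1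
  linarith

/-- A 1-Lipschitz function deviates from its Gaussian mean by at most `|w| + 1`. -/
lemma abs_sub_integral_gaussianReal_le {h : ℝ → ℝ} (hLip : ∀ a b, |h a - h b| ≤ |a - b|)
    (w : ℝ) : |h w - ∫ t, h t ∂gaussianReal 0 1| ≤ |w| + 1 := by
  have hid : Integrable (fun t : ℝ => |t|) (gaussianReal 0 1) :=
    ((memLp_id_gaussianReal' 1 (by simp)).integrable le_rfl).norm
  have hint : Integrable h (gaussianReal 0 1) :=
    (hid.add (integrable_const |h 0|)).mono'
      (continuous_of_abs_sub_le hLip).aestronglyMeasurable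
      (ae_of_all _ fun t => abs_le_abs_add_of_abs_sub_le hLip t)
  have heq : h w - ∫ t, h t ∂gaussianReal 0 1 = ∫ t, (h w - h t) ∂gaussianReal 0 1 := by
    rw [integral_sub (integrable_const _) hint]
    simp
  calc |h w - ∫ t, h t ∂gaussianReal 0 1| ≤ ∫ t, |h w - h t| ∂gaussianReal 0 1 := by
        rw [heq]; exact abs_integral_le_integral_abs
    _ ≤ ∫ t, (|w| + |t|) ∂gaussianReal 0 1 :=
        integral_mono ((integrable_const _).sub hint).norm ((integrable_const _).add hid)
          fun t => (hLip w t).trans (abs_sub w t)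
    _ ≤ |w| + 1 := by
        rw [integral_add (integrable_const _) hid]
        simpa using integral_abs_gaussianReal_zero_one_le

/-- Second-order Stein estimate on the positive half-line. -/
lemma abs_tail_integral_sub_le {u : ℝ → ℝ} (hLip : ∀ a b, |u a - u b| ≤ |a - b|)
    (hu : ∀ t, |u t| ≤ |t| + 1) {w : ℝ} (hw : 0 ≤ w) :
    |(1 + w ^ 2) * (∫ t in Set.Ioi w, u t * gaussianWeight t) - w * u w * gaussianWeight w| ≤
      3 * gaussianWeight w := by
  have huint := integrable_mul_gaussianWeight_of_abs_le (continuous_of_abs_sub_le hLip) hu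
  set Q := ∫ t in Set.Ioi w, gaussianWeight t with hQ
  set R := ∫ t in Set.Ioi w, (u t - u w) * gaussianWeight t with hR
  have hsplit : ∫ t in Set.Ioi w, u t * gaussianWeight t = u w * Q + R := by
    rw [hR]
    simp_rw [sub_mul]
    rw [integral_sub huint.integrableOn (integrable_gaussianWeight.const_mul _).integrableOn,
      integral_const_mul]
    ring
  have hRle : |R| ≤ gaussianWeight w - w * Q := by
    rw [← integral_Ioi_sub_mul_gaussianWeight]
    refine norm_integral_le_of_norm_le (f := fun t => (u t - u w) * gaussianWeight t) ?_ ?_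
    · simp_rw [sub_mul]
      exact (integrable_id_mul_gaussianWeight.sub
        (integrable_gaussianWeight.const_mul _)).integrableOn
    · filter_upwards [ae_restrict_mem measurableSet_Ioi] with t ht
      rw [Real.norm_eq_abs, abs_mul, abs_of_pos (gaussianWeight_pos t)]
      refine mul_le_mul_of_nonneg_right ?_ (gaussianWeight_pos t).le
      exact (hLip t w).trans_eq (abs_of_pos (sub_pos.2 ht))
  have hD := mul_gaussianWeight_le_tail w
  have hQle := tail_gaussianWeight_le hw
  rw [← hQ] at hD hQle
  have huw := hu w
  rw [abs_of_nonneg hw] at huw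
  have hw2 : 0 ≤ 1 + w ^ 2 := by positivity
  have hδ : 0 ≤ gaussianWeight w - w * Q := (abs_nonneg R).trans hRle
  calc _ = |u w * ((1 + w ^ 2) * Q - w * gaussianWeight w) + (1 + w ^ 2) * R| := by
        rw [hsplit]; ring_nf
    _ ≤ |u w| * ((1 + w ^ 2) * Q - w * gaussianWeight w) + (1 + w ^ 2) * |R| := by
        refine (abs_add_le _ _).trans_eq ?_
        rw [abs_mul, abs_mul, abs_of_nonneg (sub_nonneg.2 hD), abs_of_nonneg hw2]
    _ ≤ (w + 1) * ((1 + w ^ 2) * Q - w * gaussianWeight w) +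
          (1 + w ^ 2) * (gaussianWeight w - w * Q) :=
        add_le_add (mul_le_mul_of_nonneg_right huw (sub_nonneg.2 hD))
          (mul_le_mul_of_nonneg_left hRle hw2)
    _ = gaussianWeight w + Q - w * (gaussianWeight w - w * Q) := by ring
    _ ≤ 3 * gaussianWeight w := by linarith [mul_nonneg hw hδ]

/-- The second-order Stein estimate on the whole line, for centred functions. -/
lemma abs_tail_integral_sub_le_of_integral_eq_zero {u : ℝ → ℝ}
    (hLip : ∀ a b, |u a - u b| ≤ |a - b|) (hu : ∀ t, |u t| ≤ |t| + 1)
    (hzero : ∫ t, u t * gaussianWeight t = 0) (w : ℝ) :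
    |(1 + w ^ 2) * (∫ t in Set.Ioi w, u t * gaussianWeight t) - w * u w * gaussianWeight w| ≤
      3 * gaussianWeight w := by
  rcases le_total 0 w with hw | hw
  · exact abs_tail_integral_sub_le hLip hu hw
  have huint := integrable_mul_gaussianWeight_of_abs_le (continuous_of_abs_sub_le hLip) hu
  have h := abs_tail_integral_sub_le (u := fun t => u (-t)) (w := -w)
    (fun a b => (hLip (-a) (-b)).trans_eq (by rw [← abs_neg]; ring_nf))
    (fun t => (hu (-t)).trans_eq (by rw [abs_neg])) (by linarith)
  have hneg : ∫ t in Set.Ioi (-w), u (-t) * gaussianWeight t =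
      ∫ t in Set.Iic w, u t * gaussianWeight t := by
    have := integral_comp_neg_Ioi (-w) fun t => u t * gaussianWeight t
    simpa only [gaussianWeight_neg, neg_neg] using this
  have hadd := intervalIntegral.integral_Iic_add_Ioi (b := w) huint.integrableOn
    huint.integrableOn
  rw [hzero] at hadd
  rw [hneg, neg_neg, gaussianWeight_neg, eq_neg_of_add_eq_zero_left hadd] at h
  rw [← abs_neg]
  refine le_of_eq_of_le ?_ h
  ring_nf

lemma hasDerivAt_integral_Ioi {g : ℝ → ℝ} (hg : Continuous g) (hint : Integrable g) (w : ℝ) :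
    HasDerivAt (fun w => ∫ t in Set.Ioi w, g t) (-g w) w := by
  have h : (fun w => ∫ t in Set.Ioi w, g t) =
      fun w => (∫ t in Set.Ioi 0, g t) - ∫ t in (0 : ℝ)..w, g t := by
    funext w
    rw [← intervalIntegral.integral_interval_add_Ioi (a := 0) (b := w) hint.integrableOn
      hint.integrableOn]
    ring
  rw [h]
  exact (hg.integral_hasStrictDerivAt 0 w).hasDerivAt.const_sub _

/-- The Stein equation for the standard Gaussian and a 1-Lipschitz function has a solution whose
derivative is 4-Lipschitz. -/
lemma exists_stein_solution {h : ℝ → ℝ} (hLip : ∀ a b, |h a - h b| ≤ |a - b|) :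
    ∃ f f' : ℝ → ℝ, (∀ w, HasDerivAt f (f' w) w) ∧
      (∀ w, f' w - w * f w = h w - ∫ t, h t ∂gaussianReal 0 1) ∧
      ∀ a b, |f' a - f' b| ≤ 4 * |a - b| := by
  set c := ∫ t, h t ∂gaussianReal 0 1 with hc
  set u : ℝ → ℝ := fun t => h t - c with hu_def
  have huLip : ∀ a b, |u a - u b| ≤ |a - b| := fun a b => by simpa [hu_def] using hLip a b
  have hu : ∀ t, |u t| ≤ |t| + 1 := abs_sub_integral_gaussianReal_le hLip
  have hucont := continuous_of_abs_sub_le huLip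
  have huint := integrable_mul_gaussianWeight_of_abs_le hucont hu
  have hzero : ∫ t, u t * gaussianWeight t = 0 := by
    have hh := integrable_mul_gaussianWeight_of_abs_le (continuous_of_abs_sub_le hLip)
      (abs_le_abs_add_of_abs_sub_le hLip)
    have hg : ∫ t, gaussianWeight t = √(2 * Real.pi) := by
      simp only [gaussianWeight, integral_gaussian]
      congr 1
      ring
    have hpos : √(2 * Real.pi) ≠ 0 := by positivity
    simp_rw [hu_def, sub_mul]
    rw [integral_sub hh (integrable_gaussianWeight.const_mul _), integral_const_mul, hg, hc,
      integral_gaussianReal_zero_one]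
    field_simp
    ring
  set G : ℝ → ℝ := fun w => ∫ t in Set.Ioi w, u t * gaussianWeight t with hG
  set f : ℝ → ℝ := fun w => -(G w / gaussianWeight w) with hf
  have hderiv : ∀ w, HasDerivAt f (w * f w + u w) w := fun w => by
    have hne := (gaussianWeight_pos w).ne'
    have hGd : HasDerivAt G (-(u w * gaussianWeight w)) w :=
      hasDerivAt_integral_Ioi (hucont.mul continuous_gaussianWeight) huint w
    refine (hGd.div
      (hasDerivAt_gaussianWeight w) hne).neg.congr_deriv ?_
    simp only [hf]
    field_simp
    ring
  have hbound : ∀ w, |1 * f w + w * (w * f w + u w)| ≤ 3 := fun w => by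
    have hne := (gaussianWeight_pos w).ne'
    have hb := abs_tail_integral_sub_le_of_integral_eq_zero huLip hu hzero w
    have heq : 1 * f w + w * (w * f w + u w) =
        -(((1 + w ^ 2) * G w - w * u w * gaussianWeight w) / gaussianWeight w) := by
      simp only [hf]
      field_simp
      ring
    rw [heq, abs_neg, abs_div, abs_of_pos (gaussianWeight_pos w),
      div_le_iff₀ (gaussianWeight_pos w)]
    exact hb
  have hmul : ∀ a b, |a * f a - b * f b| ≤ 3 * |a - b| := fun a b =>
    convex_univ.norm_image_sub_le_of_norm_hasDerivWithin_le
      (f := fun w => w * f w) (f' := fun w => 1 * f w + w * (w * f w + u w))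
      (fun w _ => ((hasDerivAt_id w).mul (hderiv w)).hasDerivWithinAt)
      (fun w _ => hbound w) (Set.mem_univ b) (Set.mem_univ a)
  refine ⟨f, fun w => w * f w + u w, hderiv, fun w => by simp [hu_def], fun a b => ?_⟩
  calc _ = |(a * f a - b * f b) + (u a - u b)| := by ring_nf
    _ ≤ 3 * |a - b| + |a - b| := (abs_add_le _ _).trans (add_le_add (hmul a b) (huLip a b))
    _ = 4 * |a - b| := by ring

/-- The Stein equation for a centred Gaussian of positive variance. -/
lemma exists_stein_solution_of_variance {v : ℝ≥0} (hv : 0 < v) {h : ℝ → ℝ}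
    (hLip : ∀ a b, |h a - h b| ≤ |a - b|) :
    ∃ f f' : ℝ → ℝ, (∀ w, HasDerivAt f (f' w) w) ∧
      (∀ w, v * f' w - w * f w = h w - ∫ t, h t ∂gaussianReal 0 v) ∧
      ∀ a b, v * |f' a - f' b| ≤ 4 * |a - b| := by
  set s : ℝ := √v with hs_def
  have hs : 0 < s := Real.sqrt_pos.2 (by exact_mod_cast hv)
  have hsq : s ^ 2 = v := Real.sq_sqrt v.2
  have hmap : (gaussianReal 0 1).map (s * ·) = gaussianReal 0 v := by
    rw [gaussianReal_map_const_mul]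
    congr 1
    · simp
    · ext; simpa using hsq
  have hint : ∫ t, h t ∂gaussianReal 0 v = s * ∫ t, s⁻¹ * h (s * t) ∂gaussianReal 0 1 := by
    rw [← hmap, integral_map (by fun_prop)
      (continuous_of_abs_sub_le hLip).aestronglyMeasurable, integral_const_mul,
      mul_inv_cancel_left₀ hs.ne']
  obtain ⟨f, f', hf, hstein, hf'⟩ := exists_stein_solution (h := fun t => s⁻¹ * h (s * t))
    fun a b => by
      rw [← mul_sub, abs_mul, abs_of_pos (inv_pos.2 hs), inv_mul_le_iff₀ hs]
      refine (hLip _ _).trans_eq ?_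
      rw [← mul_sub, abs_mul, abs_of_pos hs]
  refine ⟨fun w => f (w / s), fun w => f' (w / s) / s, fun w => ?_, fun w => ?_,
    fun a b => ?_⟩
  · exact ((hf (w / s)).comp w ((hasDerivAt_id w).div_const s)).congr_deriv (by ring)
  · have h1 := hstein (w / s)
    simp only [mul_div_cancel₀ w hs.ne'] at h1
    rw [hint, ← hsq]
    field_simp at h1 ⊢
    linear_combination h1
  · rw [← sub_div, abs_div, abs_of_pos hs, ← hsq]
    have h1 := hf' (a / s) (b / s)
    rw [← sub_div, abs_div, abs_of_pos hs] at h1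
    calc s ^ 2 * (|f' (a / s) - f' (b / s)| / s) = s * |f' (a / s) - f' (b / s)| := by
          field_simp
      _ ≤ s * (4 * (|a - b| / s)) := mul_le_mul_of_nonneg_left h1 hs.le
      _ = 4 * |a - b| := by field_simp

end Stein

/-- First-order Taylor estimate for a function with Lipschitz derivative. -/
lemma abs_sub_sub_mul_deriv_le {f f' : ℝ → ℝ} (hf : ∀ w, HasDerivAt f (f' w) w) {L : ℝ}
    (hL : ∀ a b, |f' a - f' b| ≤ L * |a - b|) (a b : ℝ) :
    |f b - f a - f' a * (b - a)| ≤ L / 2 * (b - a) ^ 2 := by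
  have key : ∀ {g g' : ℝ → ℝ}, (∀ w, HasDerivAt g (g' w) w) →
      (∀ a b, |g' a - g' b| ≤ L * |a - b|) → ∀ {a b : ℝ}, a ≤ b →
      |g b - g a - g' a * (b - a)| ≤ L / 2 * (b - a) ^ 2 := by
    intro g g' hg hg' a b hab
    have h := image_norm_le_of_norm_deriv_right_le_deriv_boundary
      (f := fun t => g t - g a - g' a * (t - a)) (f' := fun t => g' t - g' a) (a := a) (b := b)
      (B := fun t => L / 2 * (t - a) ^ 2) (B' := fun t => L * (t - a))
      (fun t _ => (((hg t).continuousAt.sub continuousAt_const).sub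
        (by fun_prop)).continuousWithinAt)
      (fun t _ => ((((hg t).sub_const _).sub
        (((hasDerivAt_id t).sub_const a).const_mul (g' a))).congr_deriv
          (by simp)).hasDerivWithinAt)
      (by simp)
      (fun t => ((((hasDerivAt_id t).sub_const a).pow 2).const_mul (L / 2)).congr_deriv
        (by simp; ring))
      (fun t ht => (hg' t a).trans_eq (by rw [abs_of_nonneg (sub_nonneg.2 ht.1)]))
    exact h (Set.right_mem_Icc.2 hab)
  rcases le_total a b with hab | hab
  · exact key hf hL hab
  · have h := key (g := fun t => f (-t)) (g' := fun t => -f' (-t))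
      (fun w => ((hf (-w)).comp w (hasDerivAt_neg w)).congr_deriv (by ring))
      (fun a b => by
        have := hL (-b) (-a)
        rwa [show -f' (-a) - -f' (-b) = f' (-b) - f' (-a) by ring,
          show a - b = -b - -a by ring]) (neg_le_neg hab)
    simp only [neg_neg] at h
    convert h using 2 <;> ring

section Recursion

lemma S_succ (x : ℕ → ℝ) (n : ℕ) : S x (n + 1) = S x n + x (n + 1) :=
  Finset.sum_Icc_succ_top (by omega) _

lemma S_one (x : ℕ → ℝ) : S x 1 = x 1 := by simp [S]

/-- Summation by parts. -/
lemma sum_mul_eq_sum_S_mul (x g : ℕ → ℝ) (m : ℕ) :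
    ∑ n ∈ Finset.Icc 1 (m + 1), x n * g n =
      ∑ n ∈ Finset.Icc 1 m, S x n * (g n - g (n + 1)) + S x (m + 1) * g (m + 1) := by
  induction m with
  | zero => simp [S]
  | succ m ih =>
    rw [Finset.sum_Icc_succ_top (by omega), ih, Finset.sum_Icc_succ_top (by omega),
      S_succ x (m + 1)]
    ring

/-- Up to a boundary term, the weights `c - n` and `n` at the endpoints of the `n`-th gap give
every point the same total weight `c - 1`. -/
lemma sum_weighted_gaps (g : ℕ → ℝ) (m : ℕ) (c : ℝ) :
    ∑ n ∈ Finset.Icc 1 m, ((c - n) * g n + n * g (n + 1)) =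
      (c - 1) * ∑ n ∈ Finset.Icc 1 (m + 1), g n - (c - (m + 1)) * g (m + 1) := by
  induction m with
  | zero => simp
  | succ m ih =>
    rw [Finset.sum_Icc_succ_top (by omega), ih,
      Finset.sum_Icc_succ_top (b := m + 1) (by omega) g]
    push_cast
    ring

lemma sum_gaps (x : ℕ → ℝ) (m : ℕ) :
    ∑ n ∈ Finset.Icc 1 m, (x n - x (n + 1)) = x 1 - x (m + 1) := by
  induction m with
  | zero => simp
  | succ m ih => rw [Finset.sum_Icc_succ_top (by omega), ih]; ring

/-- Solutions with positive partial sums are strictly monotone in the initial value. -/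
lemma IsSolution.lt_of_initial_lt {N : ℕ} {x y : ℕ → ℝ} (hx : IsSolution N x)
    (hy : IsSolution N y) (hpos : ∀ n, 1 ≤ n → n ≤ N - 1 → 0 < S x n) (h1 : x 1 < y 1)
    (n : ℕ) (hn : n + 1 ≤ N) : x (n + 1) < y (n + 1) ∧ S x (n + 1) < S y (n + 1) := by
  induction n with
  | zero => simpa [S_one] using h1
  | succ n ih =>
    obtain ⟨ihx, ihS⟩ := ih (by omega)
    have hlt : x (n + 1 + 1) < y (n + 1 + 1) := by
      rw [(hx (n + 1) (by omega) (by omega)).2, (hy (n + 1) (by omega) (by omega)).2]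
      have := one_div_lt_one_div_of_lt (hpos (n + 1) (by omega) (by omega)) ihS
      linarith
    refine ⟨hlt, ?_⟩
    rw [S_succ x (n + 1), S_succ y (n + 1)]
    exact add_lt_add ihS hlt

lemma S_reflect {N : ℕ} {x : ℕ → ℝ} (hmean : S x N = 0) (n : ℕ) (hn : n ≤ N) :
    S (fun k => -x (N + 1 - k)) n = S x (N - n) := by
  induction n with
  | zero => simp only [S, Nat.sub_zero] at *; simp [hmean]
  | succ n ih =>
    rw [S_succ, ih (by omega)]
    have h := S_succ x (N - (n + 1))
    rw [show N - (n + 1) + 1 = N - n by omega] at h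
    rw [h, show N + 1 - (n + 1) = N - n by omega]
    ring

lemma IsSolution.reflect {N : ℕ} {x : ℕ → ℝ} (hx : IsSolution N x) (hmean : S x N = 0) :
    IsSolution N fun k => -x (N + 1 - k) := by
  intro n hn1 hn2
  obtain ⟨hne, hrec⟩ := hx (N - n) (by omega) (by omega)
  rw [S_reflect hmean n (by omega)]
  refine ⟨hne, ?_⟩
  change -x (N + 1 - (n + 1)) = -x (N + 1 - n) - _
  rw [show N + 1 - n = N - n + 1 by omega, hrec, show N + 1 - (n + 1) = N - n by omega]
  ring

/-- A zero-mean solution with positive partial sums has opposite extreme values. -/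
lemma IsSolution.last_eq_neg_first {N : ℕ} (hN : 1 ≤ N) {x : ℕ → ℝ} (hx : IsSolution N x)
    (hmean : S x N = 0) (hpos : ∀ n, 1 ≤ n → n ≤ N - 1 → 0 < S x n) : x N = -x 1 := by
  have hy := hx.reflect hmean
  have hyN : S (fun k => -x (N + 1 - k)) N = 0 := by
    rw [S_reflect hmean N le_rfl]; simp [S]
  have hypos : ∀ n, 1 ≤ n → n ≤ N - 1 → 0 < S (fun k => -x (N + 1 - k)) n := fun n h1 h2 => by
    rw [S_reflect hmean n (by omega)]
    exact hpos _ (by omega) (by omega)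
  have hN1 : N - 1 + 1 = N := by omega
  have h1 : ¬ x 1 < -x (N + 1 - 1) := fun h => by
    have := (hx.lt_of_initial_lt hy hpos h (N - 1) (by omega)).2
    rw [hN1, hmean, hyN] at this
    exact lt_irrefl _ this
  have h2 : ¬ -x (N + 1 - 1) < x 1 := fun h => by
    have := (hy.lt_of_initial_lt hx hypos h (N - 1) (by omega)).2
    rw [hN1, hmean, hyN] at this
    exact lt_irrefl _ this
  rw [Nat.add_sub_cancel] at h1 h2
  linarith

end Recursion

/-- Stein upper bound: for `γ_N` the Gaussian with mean `0` and variance `(N-1)/N`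
(the mean and variance of the empirical distribution `𝕡_N`) and every 1-Lipschitz
`h : ℝ → ℝ`, the difference of expectations is at most `4 x_{N,1} / (N-1)`; hence the
Wasserstein distance between `𝕡_N` and `γ_N` is at most `4 x_{N,1} / (N-1)`. -/
theorem wasserstein_upper_bound (N : ℕ) (hN : 3 ≤ N) (x : ℕ → ℝ)
    (hsol : IsSolution N x) (hdec : ∀ n, 1 ≤ n → n < N → x (n + 1) < x n)
    (hmean : ∑ i ∈ Finset.Icc 1 N, x i = 0)
    (h : ℝ → ℝ) (hLip : ∀ a b, |h a - h b| ≤ |a - b|) :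
    |(1 / (N : ℝ)) * ∑ n ∈ Finset.Icc 1 N, h (x n) -
        ∫ t, h t ∂(gaussianReal 0 (((N - 1 : ℕ) : ℝ≥0) / (N : ℝ≥0)))| ≤
      4 * x 1 / ((N : ℝ) - 1) := by
  have hS : S x N = 0 := hmean
  have hpos : ∀ n, 1 ≤ n → n ≤ N - 1 → 0 < S x n := fun n h1 h2 => by
    have hlt := hdec n h1 (by omega)
    rw [(hsol n h1 h2).2, sub_lt_self_iff] at hlt
    exact one_div_pos.1 hlt
  have hlast := hsol.last_eq_neg_first (by omega) hS hpos
  obtain ⟨m, rfl⟩ : ∃ m, N = m + 1 := ⟨N - 1, by omega⟩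
  rw [Nat.add_sub_cancel] at hpos ⊢
  have hm : (0 : ℝ) < m := by exact_mod_cast (by omega : 0 < m)
  set v : ℝ≥0 := (m : ℝ≥0) / ((m + 1 : ℕ) : ℝ≥0) with hv_def
  have hvr : (v : ℝ) = m / (m + 1) := by simp [hv_def]
  have hv : 0 < v := by
    rw [← NNReal.coe_pos, hvr]; positivity
  obtain ⟨f, f', hf, hstein, hf'⟩ := exists_stein_solution_of_variance hv hLip
  set c := ∫ t, h t ∂gaussianReal 0 v with hc
  have hvpos : (0 : ℝ) < v := by exact_mod_cast hv
  have hL : ∀ a b, |f' a - f' b| ≤ 4 / v * |a - b| := fun a b => by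
    rw [div_mul_eq_mul_div, le_div_iff₀ hvpos, mul_comm]
    exact hf' a b
  have herr : ∑ n ∈ Finset.Icc 1 (m + 1), h (x n) - (m + 1) * c =
      ∑ n ∈ Finset.Icc 1 m, ((((m + 1 : ℝ) - n) / (m + 1) * f' (x n) +
        n / (m + 1) * f' (x (n + 1))) - S x n * (f (x n) - f (x (n + 1)))) := by
    have h1 : ∑ n ∈ Finset.Icc 1 (m + 1), (h (x n) - c) =
        ∑ n ∈ Finset.Icc 1 (m + 1), (v * f' (x n) - x n * f (x n)) :=
      Finset.sum_congr rfl fun n _ => (hstein (x n)).symm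
    have h2 := sum_mul_eq_sum_S_mul x (fun n => f (x n)) m
    have h3 := sum_weighted_gaps (fun n => f' (x n)) m (m + 1)
    rw [Finset.sum_sub_distrib, Finset.sum_sub_distrib, ← Finset.mul_sum, h2, hS, hvr] at h1
    have h4 : ∑ n ∈ Finset.Icc 1 m, (((m + 1 : ℝ) - n) / (m + 1) * f' (x n) +
        n / (m + 1) * f' (x (n + 1))) = m / (m + 1) * ∑ n ∈ Finset.Icc 1 (m + 1), f' (x n) := by
      rw [div_mul_eq_mul_div, eq_div_iff (by positivity), Finset.sum_mul]
      convert h3 using 1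
      · refine Finset.sum_congr rfl fun n _ => ?_
        field_simp
      · ring
    rw [Finset.sum_sub_distrib, h4]
    simp only [Finset.sum_const, Nat.card_Icc, Nat.add_sub_cancel, nsmul_eq_mul] at h1
    push_cast at h1
    linarith
  have hlocal : ∀ n ∈ Finset.Icc 1 m, |(((m + 1 : ℝ) - n) / (m + 1) * f' (x n) +
      n / (m + 1) * f' (x (n + 1))) - S x n * (f (x n) - f (x (n + 1)))| ≤
      4 / v / 2 * (x n - x (n + 1)) := fun n hn => by
    rw [Finset.mem_Icc] at hn
    have hSn := hpos n hn.1 hn.2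
    have hd : x n - x (n + 1) = 1 / S x n := by
      rw [(hsol n hn.1 (by omega)).2]; ring
    have hSd : S x n * (x n - x (n + 1)) = 1 := by rw [hd]; field_simp
    have hnm : (n : ℝ) ≤ m := by exact_mod_cast hn.2
    have hα : 0 ≤ ((m + 1 : ℝ) - n) / (m + 1) := by
      apply div_nonneg <;> linarith
    have hβ : 0 ≤ (n : ℝ) / (m + 1) := by positivity
    have hαβ : ((m + 1 : ℝ) - n) / (m + 1) + n / (m + 1) = 1 := by field_simp; ring
    have hslope : ∀ a b, (a - b) ^ 2 = (x n - x (n + 1)) ^ 2 →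
        |S x n * (f b - f a - f' a * (b - a))| ≤ 4 / v / 2 * (x n - x (n + 1)) :=
      fun a b hab => by
        rw [abs_mul, abs_of_pos hSn]
        refine (mul_le_mul_of_nonneg_left (abs_sub_sub_mul_deriv_le hf hL a b) hSn.le).trans_eq ?_
        rw [show (b - a) ^ 2 = (x n - x (n + 1)) ^ 2 by rw [← hab]; ring]
        linear_combination (4 / (v : ℝ) / 2 * (x n - x (n + 1))) * hSd
    have h1 := hslope (x n) (x (n + 1)) rfl
    have h2 := hslope (x (n + 1)) (x n) (by ring)
    generalize ((m + 1 : ℝ) - n) / (m + 1) = α at *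
    generalize (n : ℝ) / (m + 1) = β at *
    have heq : α * f' (x n) + β * f' (x (n + 1)) - S x n * (f (x n) - f (x (n + 1))) =
        α * (S x n * (f (x (n + 1)) - f (x n) - f' (x n) * (x (n + 1) - x n))) -
        β * (S x n * (f (x n) - f (x (n + 1)) - f' (x (n + 1)) * (x n - x (n + 1)))) := by
      linear_combination (-α * f' (x n) - β * f' (x (n + 1))) * hSd +
        (S x n * (f (x n) - f (x (n + 1)))) * hαβ
    rw [heq]
    refine (abs_sub _ _).trans ?_
    rw [abs_mul α, abs_mul β, abs_of_nonneg hα, abs_of_nonneg hβ]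
    calc _ ≤ α * (4 / v / 2 * (x n - x (n + 1))) + β * (4 / v / 2 * (x n - x (n + 1))) :=
          add_le_add (mul_le_mul_of_nonneg_left h1 hα) (mul_le_mul_of_nonneg_left h2 hβ)
      _ = _ := by rw [← add_mul, hαβ, one_mul]
  have htotal : |∑ n ∈ Finset.Icc 1 (m + 1), h (x n) - (m + 1) * c| ≤
      4 / v / 2 * (2 * x 1) := by
    rw [herr]
    refine (Finset.abs_sum_le_sum_abs _ _).trans ((Finset.sum_le_sum hlocal).trans_eq ?_)
    rw [← Finset.mul_sum, sum_gaps, hlast]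
    ring
  rw [hvr] at htotal
  push_cast
  rw [show 1 / ((m : ℝ) + 1) * ∑ n ∈ Finset.Icc 1 (m + 1), h (x n) - c =
    (∑ n ∈ Finset.Icc 1 (m + 1), h (x n) - (m + 1) * c) / (m + 1) by field_simp,
    abs_div, abs_of_pos (by positivity : (0 : ℝ) < m + 1), div_le_iff₀ (by positivity)]
  refine htotal.trans_eq ?_
  rw [add_sub_cancel_right]
  field_simp
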